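/- For all Boolean normal monotonic (BNM) schemes 𝕏 and 𝕏', the sets SS(𝕏) and TT(𝕏') are incomparable under inclusion: for distinct propositional variables p and r, the inference {p ∧ ¬p} ⇒ r belongs to SS(𝕏) but not to TT(𝕏'), and the inference ∅ ⇒ p ∨ ¬p belongs to TT(𝕏') but not to SS(𝕏). -/

import Mathlib

namespace ThreeValued

/-- Formulas of the propositional language: countably many variables,
negation, conjunction, disjunction. -/
inductive Fml : Type
  | var : ℕ → Fml
  | neg : Fml → Fml
  | conj : Fml → Fml → Fml
  | disj : Fml → Fml → Fml
deriving DecidableEq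

/-- An inference Γ ⇒ φ: a finite set of premises and a conclusion. -/
structure Infer : Type where
  prem : Finset Fml
  concl : Fml

/-- A set of inferences is closed under transitivity:
whenever there is a nonempty Δ with Δ ⇒ φ ∈ L and Γ ⇒ δ ∈ L for all δ ∈ Δ,
then Γ ⇒ φ ∈ L. -/
def TransClosed (L : Set Infer) : Prop :=
  ∀ (Γ Δ : Finset Fml) (φ : Fml), Δ.Nonempty →
    (⟨Δ, φ⟩ : Infer) ∈ L → (∀ δ ∈ Δ, (⟨Γ, δ⟩ : Infer) ∈ L) → (⟨Γ, φ⟩ : Infer) ∈ L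

/-- The transitive closure of a set of inferences: the least superset closed
under transitivity. -/
def T (L : Set Infer) : Set Infer := ⋂₀ {L' : Set Infer | L ⊆ L' ∧ TransClosed L'}

/-- A set of inferences is open under dual transitivity:
whenever there is a nonempty Δ with Δ ⇒ φ ∉ L and Γ ⇒ δ ∉ L for all δ ∈ Δ,
then Γ ⇒ φ ∉ L. -/
def DualTransClosed (L : Set Infer) : Prop :=
  ∀ (Γ Δ : Finset Fml) (φ : Fml), Δ.Nonempty →
    (⟨Δ, φ⟩ : Infer) ∉ L → (∀ δ ∈ Δ, (⟨Γ, δ⟩ : Infer) ∉ L) → (⟨Γ, φ⟩ : Infer) ∉ L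

/-- The dual transitive closure: the greatest subset open under dual
transitivity. -/
def Td (L : Set Infer) : Set Infer := ⋃₀ {L' : Set Infer | L' ⊆ L ∧ DualTransClosed L'}

/-- The three truth values 0, 1/2, 1. -/
inductive V3 : Type
  | zero | half | one
deriving DecidableEq

/-- A three-valued scheme: a triple of truth functions for ¬, ∧ and ∨. -/
structure Scheme : Type where
  fneg : V3 → V3
  fconj : V3 → V3 → V3
  fdisj : V3 → V3 → V3

/-- Boolean normality: on Boolean inputs the operations agree with the
classical ones. -/
def BooleanNormal (X : Scheme) : Prop :=
  X.fneg .zero = .one ∧ X.fneg .one = .zero ∧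
  X.fconj .one .one = .one ∧ X.fconj .one .zero = .zero ∧
  X.fconj .zero .one = .zero ∧ X.fconj .zero .zero = .zero ∧
  X.fdisj .one .one = .one ∧ X.fdisj .one .zero = .one ∧
  X.fdisj .zero .one = .one ∧ X.fdisj .zero .zero = .zero

/-- The information order: 1/2 is below 0 and below 1. -/
def infLe (a b : V3) : Prop := a = .half ∨ a = b

/-- Monotonicity of a scheme with respect to the information order. -/
def Monotonic (X : Scheme) : Prop :=
  (∀ a b, infLe a b → infLe (X.fneg a) (X.fneg b)) ∧
  (∀ a₁ a₂ b₁ b₂, infLe a₁ b₁ → infLe a₂ b₂ → infLe (X.fconj a₁ a₂) (X.fconj b₁ b₂)) ∧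
  (∀ a₁ a₂ b₁ b₂, infLe a₁ b₁ → infLe a₂ b₂ → infLe (X.fdisj a₁ a₂) (X.fdisj b₁ b₂))

/-- Boolean normal monotonic schemes. -/
def BNM (X : Scheme) : Prop := BooleanNormal X ∧ Monotonic X

/-- Valuations respecting a scheme. -/
def Respects (X : Scheme) (v : Fml → V3) : Prop :=
  (∀ φ, v (.neg φ) = X.fneg (v φ)) ∧
  (∀ φ ψ, v (.conj φ ψ) = X.fconj (v φ) (v ψ)) ∧
  (∀ φ ψ, v (.disj φ ψ) = X.fdisj (v φ) (v ψ))

/-- The strict formula-standard s = {1}. -/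
def sStd : Set V3 := {.one}

/-- The tolerant formula-standard t = {1, 1/2}. -/
def tStd : Set V3 := {.one, .half}

/-- An inference is xy-valid over a scheme X if every valuation respecting X
whose value on each premise is in x gives the conclusion a value in y. -/
def Valid (X : Scheme) (x y : Set V3) (I : Infer) : Prop :=
  ∀ v : Fml → V3, Respects X v → (∀ γ ∈ I.prem, v γ ∈ x) → v I.concl ∈ y

/-- The ss-valid inferences over X. -/
def SS (X : Scheme) : Set Infer := {I | Valid X sStd sStd I}

/-- The tt-valid inferences over X. -/
def TT (X : Scheme) : Set Infer := {I | Valid X tStd tStd I}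

/-- The st-valid inferences over X. -/
def ST (X : Scheme) : Set Infer := {I | Valid X sStd tStd I}

/-- The ts-valid inferences over X. -/
def TS (X : Scheme) : Set Infer := {I | Valid X tStd sStd I}

/-- Classical two-valued valuations. -/
def RespectsCL (v : Fml → Bool) : Prop :=
  (∀ φ, v (.neg φ) = ! v φ) ∧
  (∀ φ ψ, v (.conj φ ψ) = (v φ && v ψ)) ∧
  (∀ φ ψ, v (.disj φ ψ) = (v φ || v ψ))

/-- The classically valid inferences. -/
def CL : Set Infer :=
  {I | ∀ v : Fml → Bool, RespectsCL v → (∀ γ ∈ I.prem, v γ = true) → v I.concl = true}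

/-- Substitution: the homomorphic extension of a map from variables to
formulas. -/
def subst (σ : ℕ → Fml) : Fml → Fml
  | .var n => σ n
  | .neg φ => .neg (subst σ φ)
  | .conj φ ψ => .conj (subst σ φ) (subst σ ψ)
  | .disj φ ψ => .disj (subst σ φ) (subst σ ψ)

/-- Reflexivity. -/
def PropR (L : Set Infer) : Prop := ∀ φ : Fml, (⟨{φ}, φ⟩ : Infer) ∈ L

/-- Monotonicity (weakening). -/
def PropM (L : Set Infer) : Prop :=
  ∀ (Γ Sg : Finset Fml) (φ : Fml), (⟨Γ, φ⟩ : Infer) ∈ L → Γ ⊆ Sg → (⟨Sg, φ⟩ : Infer) ∈ L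

/-- Structurality (closure under substitutions). -/
def PropS (L : Set Infer) : Prop :=
  ∀ (Γ : Finset Fml) (φ : Fml), (⟨Γ, φ⟩ : Infer) ∈ L →
    ∀ σ : ℕ → Fml, (⟨Γ.image (subst σ), subst σ φ⟩ : Infer) ∈ L

/-- The Tarskian closure: the least superset satisfying (R), (M), (T), (S). -/
def Tar (L : Set Infer) : Set Infer :=
  ⋂₀ {L' : Set Infer | L ⊆ L' ∧ PropR L' ∧ PropM L' ∧ TransClosed L' ∧ PropS L'}

/-- L⋆: the inferences whose premise set is an antitheorem of L or whose
conclusion is a theorem of L. -/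
def starL (L : Set Infer) : Set Infer :=
  {I | (∀ ψ : Fml, (⟨I.prem, ψ⟩ : Infer) ∈ L) ∨ (∀ Δ : Finset Fml, (⟨Δ, I.concl⟩ : Infer) ∈ L)}

/-- The propositional variables occurring in a formula. -/
def fvars : Fml → Finset ℕ
  | .var n => {n}
  | .neg φ => fvars φ
  | .conj φ ψ => fvars φ ∪ fvars ψ
  | .disj φ ψ => fvars φ ∪ fvars ψ

/-- The valuation over a scheme extending an assignment of the variables. -/
def Scheme.eval (X : Scheme) (a : ℕ → V3) : Fml → V3
  | .var n => a n
  | .neg φ => X.fneg (X.eval a φ)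
  | .conj φ ψ => X.fconj (X.eval a φ) (X.eval a ψ)
  | .disj φ ψ => X.fdisj (X.eval a φ) (X.eval a ψ)

theorem Scheme.respects_eval (X : Scheme) (a : ℕ → V3) : Respects X (X.eval a) :=
  ⟨fun _ => rfl, fun _ _ => rfl, fun _ _ => rfl⟩

theorem infLe_half (a : V3) : infLe .half a := Or.inl rfl

theorem eq_half_of_infLe {a : V3} (h₀ : infLe a .zero) (h₁ : infLe a .one) : a = .half := by
  rcases h₀ with h | rfl
  · exact h
  · simp [infLe] at h₁

theorem BNM.fneg_half {X : Scheme} (h : BNM X) : X.fneg .half = .half := by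
  obtain ⟨⟨h₀, h₁, -⟩, hm, -⟩ := h
  exact eq_half_of_infLe (h₁ ▸ hm _ _ (infLe_half .one)) (h₀ ▸ hm _ _ (infLe_half .zero))

theorem BNM.fconj_half_half {X : Scheme} (h : BNM X) : X.fconj .half .half = .half := by
  obtain ⟨⟨-, -, h₁, -, -, h₀, -⟩, -, hm, -⟩ := h
  exact eq_half_of_infLe (h₀ ▸ hm _ _ _ _ (infLe_half .zero) (infLe_half .zero))
    (h₁ ▸ hm _ _ _ _ (infLe_half .one) (infLe_half .one))

theorem BNM.fdisj_half_half {X : Scheme} (h : BNM X) : X.fdisj .half .half = .half := by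
  obtain ⟨⟨-, -, -, -, -, -, h₁, -, -, h₀⟩, -, -, hm⟩ := h
  exact eq_half_of_infLe (h₀ ▸ hm _ _ _ _ (infLe_half .zero) (infLe_half .zero))
    (h₁ ▸ hm _ _ _ _ (infLe_half .one) (infLe_half .one))

theorem BNM.fconj_fneg_ne_one {X : Scheme} (h : BNM X) (a : V3) :
    X.fconj a (X.fneg a) ≠ .one := by
  obtain ⟨hn₀, hn₁, -, h₁₀, h₀₁, -⟩ := h.1
  cases a <;> simp [hn₀, hn₁, h₁₀, h₀₁, h.fneg_half, h.fconj_half_half]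

theorem BNM.fdisj_fneg_mem_tStd {X : Scheme} (h : BNM X) (a : V3) :
    X.fdisj a (X.fneg a) ∈ tStd := by
  obtain ⟨hn₀, hn₁, -, -, -, -, -, h₁₀, h₀₁, -⟩ := h.1
  cases a <;> simp [tStd, hn₀, hn₁, h₁₀, h₀₁, h.fneg_half, h.fdisj_half_half]

theorem BNM.explosion_mem_SS {X : Scheme} (h : BNM X) (φ ψ : Fml) :
    (⟨{.conj φ (.neg φ)}, ψ⟩ : Infer) ∈ SS X := by
  intro v hv hp
  have h₁ : v (.conj φ (.neg φ)) = .one := hp _ (Finset.mem_singleton_self _)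
  rw [hv.2.1, hv.1] at h₁
  exact absurd h₁ (h.fconj_fneg_ne_one _)

theorem BNM.explosion_notMem_TT {X : Scheme} (h : BNM X) {p r : ℕ} (hpr : p ≠ r) :
    (⟨{.conj (.var p) (.neg (.var p))}, .var r⟩ : Infer) ∉ TT X := by
  intro hT
  have hr := hT _ (X.respects_eval fun n => if n = p then .half else .zero) <| by
    simp [Scheme.eval, h.fneg_half, h.fconj_half_half, tStd]
  simp [Scheme.eval, tStd, hpr.symm] at hr

theorem BNM.excludedMiddle_mem_TT {X : Scheme} (h : BNM X) (φ : Fml) :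
    (⟨∅, .disj φ (.neg φ)⟩ : Infer) ∈ TT X := by
  intro v hv _
  change v (.disj φ (.neg φ)) ∈ tStd
  rw [hv.2.2, hv.1]
  exact h.fdisj_fneg_mem_tStd _

theorem BNM.excludedMiddle_notMem_SS {X : Scheme} (h : BNM X) (p : ℕ) :
    (⟨∅, .disj (.var p) (.neg (.var p))⟩ : Infer) ∉ SS X := by
  intro hS
  have hp := hS _ (X.respects_eval fun _ => .half) (by simp)
  simp [Scheme.eval, h.fneg_half, h.fdisj_half_half, sStd] at hp

/-- SS and TT over (possibly different) BNM schemes are incomparable, with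
explicit witnesses: {p ∧ ¬p} ⇒ r and ∅ ⇒ p ∨ ¬p. -/
theorem stmt6 : ∀ X X' : Scheme, BNM X → BNM X' →
    (¬ SS X ⊆ TT X') ∧ (¬ TT X' ⊆ SS X) ∧
    ∀ p r : ℕ, p ≠ r →
      (⟨{Fml.conj (.var p) (.neg (.var p))}, .var r⟩ : Infer) ∈ SS X ∧
      (⟨{Fml.conj (.var p) (.neg (.var p))}, .var r⟩ : Infer) ∉ TT X' ∧
      (⟨∅, Fml.disj (.var p) (.neg (.var p))⟩ : Infer) ∈ TT X' ∧
      (⟨∅, Fml.disj (.var p) (.neg (.var p))⟩ : Infer) ∉ SS X := by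
  intro X X' h h'
  exact ⟨fun hsub => h'.explosion_notMem_TT zero_ne_one (hsub (h.explosion_mem_SS _ _)),
    fun hsub => h.excludedMiddle_notMem_SS 0 (hsub (h'.excludedMiddle_mem_TT _)),
    fun p r hpr => ⟨h.explosion_mem_SS _ _, h'.explosion_notMem_TT hpr,
      h'.excludedMiddle_mem_TT _, h.excludedMiddle_notMem_SS p⟩⟩

end ThreeValued
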